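/- Let N ≥ 0 and α, β ∈ ℝ with α + β + k ≠ 0 for k = 1, 2, …, 2N+2. For 0 ≤ n ≤ N define a_n = (n+α+β+1)(n+α+1)(N−n) / [(2n+α+β+1)(2n+α+β+2)] and c_n = n(n+α+β+N+1)(n+β) / [(2n+α+β)(2n+α+β+1)] (so a_N = 0 and c_0 = 0). Let ℋ_{N+1} be the (N+1)×(N+1) tridiagonal matrix with diagonal entries a_n + c_n, superdiagonal entries a_n, and subdiagonal entries c_n. Then for every real λ, det(λ·I_{N+1} + ℋ_{N+1}) = ∏_{n=0}^{N} (λ + n). Equivalently, with λ(x) = −x, the Hahn determinant H_{N+1}(λ(x); α, β, N) equals the shifted factorial (−x)_{N+1} = ∏_{j=0}^{N}(j − x). -/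

import Mathlib

/-- The Hahn superdiagonal recurrence coefficient
`a_n = (n+α+β+1)(n+α+1)(N-n) / [(2n+α+β+1)(2n+α+β+2)]`. -/
noncomputable def hahnA (α β : ℝ) (N n : ℕ) : ℝ :=
  ((n : ℝ) + α + β + 1) * ((n : ℝ) + α + 1) * ((N : ℝ) - (n : ℝ)) /
    ((2 * (n : ℝ) + α + β + 1) * (2 * (n : ℝ) + α + β + 2))

/-- The Hahn subdiagonal recurrence coefficient
`c_n = n(n+α+β+N+1)(n+β) / [(2n+α+β)(2n+α+β+1)]`. -/
noncomputable def hahnC (α β : ℝ) (N n : ℕ) : ℝ :=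
  (n : ℝ) * ((n : ℝ) + α + β + (N : ℝ) + 1) * ((n : ℝ) + β) /
    ((2 * (n : ℝ) + α + β) * (2 * (n : ℝ) + α + β + 1))

/-- The Hahn tridiagonal 'ansatz' matrix `ℋ_{N+1}` with superdiagonal `a_n`,
subdiagonal `c_n`, and diagonal `a_n + c_n` (0-indexed, size `N + 1`). -/
noncomputable def hahnM (α β : ℝ) (N : ℕ) : Matrix (Fin (N + 1)) (Fin (N + 1)) ℝ :=
  Matrix.of fun i j =>
    if (j : ℕ) = (i : ℕ) + 1 then hahnA α β N i
    else if (i : ℕ) = (j : ℕ) + 1 then hahnC α β N i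
    else if i = j then hahnA α β N i + hahnC α β N i
    else 0

theorem ascPochhammer_succ_eval_left (k : ℕ) (x : ℝ) :
    (ascPochhammer ℝ (k + 1)).eval x = x * (ascPochhammer ℝ k).eval (x + 1) := by
  simp [ascPochhammer_succ_left, Polynomial.eval_comp]

/-- The unnormalised coefficient `(-x)_k (x+s+1)_k` in the expansion of the Hahn polynomial of
degree `x` with `s = α + β`. -/
noncomputable def hahnCoeff (s x : ℝ) (k : ℕ) : ℝ :=
  (ascPochhammer ℝ k).eval (-x) * (ascPochhammer ℝ k).eval (x + s + 1)

/-- The coefficientwise form of the three-term recurrence of the Hahn polynomials. -/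
theorem hahnCoeff_recurrence (α β : ℝ) (N n k : ℕ)
    (h0 : n = 0 ∨ 2 * (n : ℝ) + α + β ≠ 0) (h1 : 2 * (n : ℝ) + α + β + 1 ≠ 0)
    (h2 : 2 * (n : ℝ) + α + β + 2 ≠ 0) :
    (hahnA α β N n + hahnC α β N n) * hahnCoeff (α + β) n (k + 1)
      - hahnA α β N n * hahnCoeff (α + β) (n + 1) (k + 1)
      - hahnC α β N n * hahnCoeff (α + β) (n - 1) (k + 1) =
    (k + 1) * hahnCoeff (α + β) n (k + 1)
      + (α + k + 1) * (N - k) * (k + 1) * hahnCoeff (α + β) n k := by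
  have hC (h : n = 0) : hahnC α β N n = 0 := by simp [hahnC, h]
  unfold hahnCoeff
  rcases k with _ | k
  · rcases h0 with h | h0
    · rw [hC h]
      subst h
      simp only [hahnA]
      simp at h1 h2 ⊢
      field_simp
      ring
    · simp only [hahnA, hahnC, zero_add, ascPochhammer_one, ascPochhammer_zero,
        Polynomial.eval_X, Polynomial.eval_one, Nat.cast_zero]
      generalize ht : 2 * (n : ℝ) + α + β = t at *
      obtain rfl : β = t - 2 * n - α := by linarith
      field_simp
      ring
  · have l1 := ascPochhammer_succ_eval_left (k + 1) (-((n : ℝ) + 1))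
    have l2 := ascPochhammer_succ_eval_left k (-(n : ℝ))
    have r1 := ascPochhammer_succ_eval k (-(n : ℝ) + 1)
    have r2 := ascPochhammer_succ_eval (k + 1) (-(n : ℝ) + 1)
    have l3 := ascPochhammer_succ_eval_left (k + 1) (-(n : ℝ))
    have m1 := ascPochhammer_succ_eval_left (k + 1) ((n : ℝ) - 1 + (α + β) + 1)
    have m2 := ascPochhammer_succ_eval_left k ((n : ℝ) + (α + β) + 1)
    have m3 := ascPochhammer_succ_eval_left (k + 1) ((n : ℝ) + (α + β) + 1)
    have t1 := ascPochhammer_succ_eval k ((n : ℝ) + (α + β) + 1 + 1)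
    have t2 := ascPochhammer_succ_eval (k + 1) ((n : ℝ) + (α + β) + 1 + 1)
    rw [show -((n : ℝ) + 1) + 1 = -n by ring] at l1
    rw [show (n : ℝ) - 1 + (α + β) + 1 + 1 = n + (α + β) + 1 by ring] at m1
    rw [show -((n : ℝ) - 1) = -n + 1 by ring,
      show (n : ℝ) + 1 + (α + β) + 1 = n + (α + β) + 1 + 1 by ring,
      l1, l3, l2, r2, r1, m1, m3, m2, t2, t1]
    generalize (ascPochhammer ℝ k).eval (-(n : ℝ) + 1) = U
    generalize (ascPochhammer ℝ k).eval ((n : ℝ) + (α + β) + 1 + 1) = V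
    rcases h0 with h | h0
    · rw [hC h]
      subst h
      simp
    · simp only [hahnA, hahnC]
      push_cast
      generalize ht : 2 * (n : ℝ) + α + β = t at *
      obtain rfl : β = t - 2 * n - α := by linarith
      field_simp
      ring

theorem sum_range_tridiagonal (a b c : ℝ) (f : ℕ → ℝ) (m i : ℕ) (hi : i < m) :
    ∑ j ∈ Finset.range m,
      (if j = i + 1 then a else if i = j + 1 then c else if i = j then b else 0) * f j =
    (if i + 1 < m then a * f (i + 1) else 0) + b * f i + (if i = 0 then 0 else c * f (i - 1)) := by
  have h : ∀ j ∈ Finset.range m,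
      (if j = i + 1 then a else if i = j + 1 then c else if i = j then b else 0) * f j =
      (if j = i + 1 then a * f j else 0) + (if j = i then b * f j else 0)
        + (if j = i - 1 then (if i = 0 then 0 else c * f j) else 0) := by
    intro j _
    by_cases h1 : j = i + 1
    · simp [h1, show i + 1 ≠ i - 1 by omega]
    · by_cases h2 : i = j + 1
      · simp [h2, show j ≠ j + 1 + 1 by omega]
      · by_cases h3 : j = i
        · subst h3
          simp
          omega
        · have h4 : j = i - 1 → i = 0 := by omega
          simp +contextual [h1, h2, h3, Ne.symm h3, h4]
  rw [Finset.sum_congr rfl h]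
  simp only [Finset.sum_add_distrib, Finset.sum_ite_eq', Finset.mem_range, hi, if_true,
    show i - 1 < m by omega]


/-- The matrix `L` with rows `(-1)^n (-n)_k (n+s+1)_k`. -/
noncomputable def hahnCoeffMatrix (s : ℝ) (N : ℕ) : Matrix (Fin (N + 1)) (Fin (N + 1)) ℝ :=
  Matrix.of fun i j => (-1) ^ (i : ℕ) * hahnCoeff s (i : ℕ) j

/-- The matrix of multiplication by `x` on (rescaled) shifted factorials `(-x)_k`. -/
noncomputable def hahnBidiagonal (α : ℝ) (N : ℕ) : Matrix (Fin (N + 1)) (Fin (N + 1)) ℝ :=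
  Matrix.of fun i j =>
    if (j : ℕ) = (i : ℕ) + 1 then (α + (i : ℕ) + 1) * (N - (i : ℕ)) * ((i : ℕ) + 1)
    else if i = j then ((i : ℕ) : ℝ) else 0

theorem hahnM_mul_hahnCoeffMatrix (N : ℕ) (α β : ℝ)
    (hab : ∀ k : ℕ, 1 ≤ k → k ≤ 2 * N + 2 → α + β + (k : ℝ) ≠ 0) :
    hahnM α β N * hahnCoeffMatrix (α + β) N =
      hahnCoeffMatrix (α + β) N * hahnBidiagonal α N := by
  ext ⟨n, hn⟩ ⟨k, hk⟩
  have hlhs : (hahnM α β N * hahnCoeffMatrix (α + β) N) ⟨n, hn⟩ ⟨k, hk⟩ =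
      (-1) ^ n * ((hahnA α β N n + hahnC α β N n) * hahnCoeff (α + β) n k
        - hahnA α β N n * hahnCoeff (α + β) (n + 1) k
        - hahnC α β N n * hahnCoeff (α + β) (n - 1) k) := by
    have hs := sum_range_tridiagonal (hahnA α β N n) (hahnA α β N n + hahnC α β N n)
      (hahnC α β N n) (fun j => (-1) ^ j * hahnCoeff (α + β) (j : ℝ) k) (N + 1) n hn
    rw [← Fin.sum_univ_eq_sum_range (fun j => (if j = n + 1 then hahnA α β N n
      else if n = j + 1 then hahnC α β N n
      else if n = j then hahnA α β N n + hahnC α β N n else 0) *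
        ((-1) ^ j * hahnCoeff (α + β) (j : ℝ) k))] at hs
    simp only [Matrix.mul_apply, hahnM, hahnCoeffMatrix, Matrix.of_apply, Fin.ext_iff]
    rw [hs]
    have hA : (if n + 1 < N + 1 then
        hahnA α β N n * ((-1) ^ (n + 1) * hahnCoeff (α + β) ((n + 1 : ℕ) : ℝ) k) else 0) =
        hahnA α β N n * ((-1) ^ (n + 1) * hahnCoeff (α + β) (n + 1) k) := by
      split_ifs with h
      · push_cast
        rfl
      · obtain rfl : n = N := by omega
        simp [hahnA]
    rw [hA]
    rcases n with _ | n
    · simp [hahnC]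
      ring
    · simp
      ring
  have hrhs : (hahnCoeffMatrix (α + β) N * hahnBidiagonal α N) ⟨n, hn⟩ ⟨k, hk⟩ =
      (-1) ^ n * (k * hahnCoeff (α + β) n k + if k = 0 then 0 else
        (α + (k - 1 : ℕ) + 1) * (N - (k - 1 : ℕ)) * ((k - 1 : ℕ) + 1) *
          hahnCoeff (α + β) n (k - 1)) := by
    have hs := sum_range_tridiagonal 0 (k : ℝ)
      ((α + (k - 1 : ℕ) + 1) * (N - (k - 1 : ℕ)) * ((k - 1 : ℕ) + 1))
      (fun j => (-1) ^ n * hahnCoeff (α + β) (n : ℝ) j) (N + 1) k hk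
    rw [← Fin.sum_univ_eq_sum_range (fun j => (if j = k + 1 then (0 : ℝ)
      else if k = j + 1 then
        (α + (k - 1 : ℕ) + 1) * (N - (k - 1 : ℕ)) * ((k - 1 : ℕ) + 1)
      else if k = j then (k : ℝ) else 0) * ((-1) ^ n * hahnCoeff (α + β) (n : ℝ) j))] at hs
    simp only [Matrix.mul_apply, hahnBidiagonal, hahnCoeffMatrix, Matrix.of_apply, Fin.ext_iff]
    refine Eq.trans (Finset.sum_congr rfl fun j _ => ?_) (hs.trans ?_)
    · rw [mul_comm]
      refine congrArg (· * _) (?_ : _ = (if (j : ℕ) = k + 1 then (0 : ℝ)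
        else if k = (j : ℕ) + 1 then
          (α + (k - 1 : ℕ) + 1) * (N - (k - 1 : ℕ)) * ((k - 1 : ℕ) + 1)
        else if k = (j : ℕ) then (k : ℝ) else 0))
      by_cases h1 : k = (j : ℕ) + 1
      · rw [if_pos h1, if_neg (by omega), if_pos h1, h1, Nat.add_sub_cancel]
      · by_cases h2 : k = (j : ℕ)
        · simp [h2]
        · simp [h1, h2, Ne.symm h2]
    · split_ifs <;> ring
  rw [hlhs, hrhs]
  rcases k with _ | k
  · simp [hahnCoeff]
  · have hne (j : ℕ) (hj : 1 ≤ j) (hj' : j ≤ 2 * N + 2) (x : ℝ) (hx : x = α + β + j) : x ≠ 0 :=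
      hx ▸ hab j hj hj'
    rw [hahnCoeff_recurrence]
    · simp
    · rcases Nat.eq_zero_or_pos n with h | h
      · exact Or.inl h
      · exact Or.inr (hne (2 * n) (by omega) (by omega) _ (by push_cast; ring))
    · exact hne (2 * n + 1) (by omega) (by omega) _ (by push_cast; ring)
    · exact hne (2 * n + 2) (by omega) (by omega) _ (by push_cast; ring)

theorem ascPochhammer_eval_eq_prod (k : ℕ) (x : ℝ) :
    (ascPochhammer ℝ k).eval x = ∏ i ∈ Finset.range k, (x + (i : ℝ)) := by
  induction k with
  | zero => simp
  | succ k ih => rw [ascPochhammer_succ_eval, Finset.prod_range_succ, ih]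

theorem det_hahnCoeffMatrix_ne_zero (N : ℕ) (s : ℝ)
    (hs : ∀ k : ℕ, 1 ≤ k → k ≤ 2 * N + 2 → s + (k : ℝ) ≠ 0) :
    (hahnCoeffMatrix s N).det ≠ 0 := by
  rw [Matrix.det_of_isLowerTriangular]
  · refine Finset.prod_ne_zero_iff.mpr fun i _ => ?_
    simp only [hahnCoeffMatrix, Matrix.of_apply, hahnCoeff, ascPochhammer_eval_eq_prod]
    refine mul_ne_zero (by simp) (mul_ne_zero ?_ ?_) <;>
      refine Finset.prod_ne_zero_iff.mpr fun j hj => ?_ <;> rw [Finset.mem_range] at hj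
    · have : (j : ℝ) < (i : ℕ) := by exact_mod_cast hj
      linarith
    · have := hs (i + 1 + j) (by omega) (by omega)
      push_cast at this
      convert this using 1
      ring
  · intro i j hij
    replace hij : (i : ℕ) < j := hij
    simp only [hahnCoeffMatrix, Matrix.of_apply, hahnCoeff]
    rw [ascPochhammer_eval_neg_coe_nat_of_lt hij]
    simp

theorem det_smul_one_add_hahnBidiagonal (N : ℕ) (α lam : ℝ) :
    (lam • (1 : Matrix (Fin (N + 1)) (Fin (N + 1)) ℝ) + hahnBidiagonal α N).det =
      ∏ n ∈ Finset.range (N + 1), (lam + (n : ℝ)) := by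
  rw [Matrix.det_of_isUpperTriangular, ← Fin.prod_univ_eq_prod_range (fun n => lam + (n : ℝ))]
  · simp [hahnBidiagonal]
  · intro i j hij
    replace hij : j < i := hij
    have h : (j : ℕ) ≠ i + 1 := by omega
    simp [hahnBidiagonal, hij.ne', h]

theorem hahn_det (N : ℕ) (α β : ℝ)
    (hab : ∀ k : ℕ, 1 ≤ k → k ≤ 2 * N + 2 → α + β + (k : ℝ) ≠ 0) :
    (∀ lam : ℝ,
      (lam • (1 : Matrix (Fin (N + 1)) (Fin (N + 1)) ℝ) + hahnM α β N).det =
        ∏ n ∈ Finset.range (N + 1), (lam + (n : ℝ))) ∧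
    (∀ x : ℝ,
      ((-x) • (1 : Matrix (Fin (N + 1)) (Fin (N + 1)) ℝ) + hahnM α β N).det =
        ∏ j ∈ Finset.range (N + 1), ((j : ℝ) - x)) := by
  have key (lam : ℝ) : (lam • (1 : Matrix (Fin (N + 1)) (Fin (N + 1)) ℝ) + hahnM α β N).det =
      ∏ n ∈ Finset.range (N + 1), (lam + (n : ℝ)) := by
    rw [← det_smul_one_add_hahnBidiagonal N α]
    apply mul_right_cancel₀ (det_hahnCoeffMatrix_ne_zero N (α + β) hab)
    rw [← Matrix.det_mul, mul_comm, ← Matrix.det_mul, add_mul, mul_add,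
      hahnM_mul_hahnCoeffMatrix N α β hab]
    simp
  refine ⟨key, fun x => ?_⟩
  rw [key]
  exact Finset.prod_congr rfl fun j _ => by ring
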